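/- arXiv:1810.01122 — 3 statements merged into one kernel-verified Lean document; each statement's English description precedes it below -/
import Mathlib

section
/- Let n ≥ 1 and let S ⊆ S' be additive submonoids of ℤⁿ. Suppose there exists a positive integer m such that m • s ∈ S for every s ∈ S'. Then the ring homomorphism AddMonoidAlgebra ℂ S → AddMonoidAlgebra ℂ S' induced by the inclusion S ⊆ S' is integral, i.e., every element of the monoid algebra ℂ[S'] is integral over the image of ℂ[S']. -/
/-- If `S ⊆ S'` are additive submonoids of `ℤⁿ` and some positive multiple of every element of
`S'` lies in `S`, then the induced map `ℂ[S] → ℂ[S']` of monoid algebras is integral. -/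
theorem monoidAlgebra_inclusion_isIntegral
    (n : ℕ) (hn : 1 ≤ n) (S S' : AddSubmonoid (Fin n → ℤ)) (hSS' : S ≤ S')
    (hmult : ∃ m : ℕ, 0 < m ∧ ∀ s : Fin n → ℤ, s ∈ S' → m • s ∈ S) :
    (AddMonoidAlgebra.mapDomainRingHom ℂ (AddSubmonoid.inclusion hSS')).IsIntegral := by
  obtain ⟨m, hm, h⟩ := hmult
  intro x
  induction x using AddMonoidAlgebra.induction_linear with
  | zero => exact RingHom.isIntegralElem_zero _
  | add x y hx hy => exact RingHom.IsIntegralElem.add _ hx hy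
  | single q c =>
    refine ⟨Polynomial.X ^ m - Polynomial.C
      (AddMonoidAlgebra.single (⟨m • (q : Fin n → ℤ), h q q.2⟩ : S) (c ^ m)),
      Polynomial.monic_X_pow_sub_C _ hm.ne', ?_⟩
    rw [Polynomial.eval₂_sub, Polynomial.eval₂_X_pow, Polynomial.eval₂_C,
      AddMonoidAlgebra.single_pow, AddMonoidAlgebra.mapDomainRingHom_apply,
      AddMonoidAlgebra.mapDomain_single, sub_eq_zero]
    rfl
end

section
/- Let n ≥ 1, let W be a finite set of nonzero vectors in ℕⁿ, let u : W → ℤ, and let k ≥ 1. Define A_k = { α ∈ ℕⁿ : ⟨α, w⟩ ≥ −k·u_w for all w ∈ W }, and let I_k be the ideal of ℂ[x₁, …, xₙ] spanned over ℂ by the monomials x^α with α ∈ A_k. Let l = (l₁, …, lₙ) be a tuple of positive integers such that l_i·e_i ∈ A_1 for every i (e_i the i-th standard basis vector). Then I_k is generated, as an ideal, by the finite set of monomials x^α with α ∈ A_k and α_i ≤ k·l_i for all i. -/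
open MvPolynomial in
/-- The ideal `I_k` (the `ℂ`-span of the monomials `x^α` with `α ∈ A_k`) is generated as an
ideal by the finitely many monomials `x^α` with `α ∈ A_k` and `α_i ≤ k·l_i` for all `i`,
whenever `l_i·e_i ∈ A_1` for each `i`. -/
theorem ideal_of_polyhedron_generated_by_box
    (n : ℕ) (hn : 1 ≤ n) (W : Finset (Fin n → ℕ)) (hW : ∀ w ∈ W, w ≠ 0)
    (u : (Fin n → ℕ) → ℤ) (k : ℕ) (hk : 1 ≤ k)
    (l : Fin n → ℕ) (hl : ∀ i, 0 < l i)
    (hle : ∀ i, ∀ w ∈ W, -(u w) ≤ (l i : ℤ) * (w i : ℤ)) :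
    Submodule.span ℂ {p : MvPolynomial (Fin n) ℂ |
        ∃ α : Fin n →₀ ℕ,
          (∀ w ∈ W, -((k : ℤ) * u w) ≤ ∑ i, (α i : ℤ) * (w i : ℤ)) ∧
          p = monomial α 1}
      = Submodule.restrictScalars ℂ
          (Ideal.span {p : MvPolynomial (Fin n) ℂ |
            ∃ α : Fin n →₀ ℕ,
              (∀ w ∈ W, -((k : ℤ) * u w) ≤ ∑ i, (α i : ℤ) * (w i : ℤ)) ∧
              (∀ i, α i ≤ k * l i) ∧
              p = monomial α 1}) := by
  apply le_antisymm
  · rw [Submodule.span_le]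
    rintro p ⟨α, hα, rfl⟩
    have key : ∃ β : Fin n →₀ ℕ, β ≤ α ∧
        (∀ w ∈ W, -((k : ℤ) * u w) ≤ ∑ i, (β i : ℤ) * (w i : ℤ)) ∧ (∀ i, β i ≤ k * l i) := by
      by_cases h : ∀ i, α i ≤ k * l i
      · exact ⟨α, le_rfl, hα, h⟩
      · push Not at h
        obtain ⟨i, hi⟩ := h
        refine ⟨Finsupp.single i (k * l i), ?_, ?_, ?_⟩
        · rw [Finsupp.single_le_iff]
          exact hi.le
        · intro w hw
          rw [Finset.sum_eq_single i]
          · have := mul_le_mul_of_nonneg_left (hle i w hw) (Int.natCast_nonneg k)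
            simp only [Finsupp.single_eq_same]
            push_cast
            linarith
          · intro j _ hj
            simp [Finsupp.single_apply, hj.symm]
          · simp
        · intro j
          by_cases hj : i = j
          · subst hj; simp
          · simp [Finsupp.single_apply, hj]
    obtain ⟨β, hβ, h1, h2⟩ := key
    have e : (monomial α (1 : ℂ)) = monomial (α - β) 1 * monomial β 1 := by
      rw [monomial_mul, tsub_add_cancel_of_le hβ, one_mul]
    simp only [Submodule.coe_restrictScalars, SetLike.mem_coe]
    rw [e]
    exact Ideal.mul_mem_left _ _ (Ideal.subset_span ⟨β, h1, h2, rfl⟩)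
  · intro p hp
    rw [Submodule.restrictScalars_mem] at hp
    induction hp using Submodule.span_induction with
    | mem x hx =>
      obtain ⟨α, h1, _, rfl⟩ := hx
      exact Submodule.subset_span ⟨α, h1, rfl⟩
    | zero => exact Submodule.zero_mem _
    | add x y _ _ hx hy => exact Submodule.add_mem _ hx hy
    | smul a x hx0 hx =>
      clear hx0
      rw [smul_eq_mul]
      induction hx using Submodule.span_induction with
      | mem x hx =>
        obtain ⟨α, h1, rfl⟩ := hx
        induction a using MvPolynomial.induction_on' with
        | monomial γ c =>
          have e : monomial γ c * monomial α (1 : ℂ) = c • monomial (γ + α) (1 : ℂ) := by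
            rw [monomial_mul, smul_monomial, smul_eq_mul]
          rw [e]
          refine Submodule.smul_mem _ _ (Submodule.subset_span ⟨γ + α, ?_, rfl⟩)
          intro w hw
          refine (h1 w hw).trans (Finset.sum_le_sum fun i _ => ?_)
          refine mul_le_mul_of_nonneg_right ?_ (Int.natCast_nonneg _)
          simp
        | add p q hp hq =>
          rw [add_mul]
          exact Submodule.add_mem _ hp hq
      | zero => rw [mul_zero]; exact Submodule.zero_mem _
      | add x y _ _ hx hy =>
        rw [mul_add]
        exact Submodule.add_mem _ hx hy
      | smul c x _ hx =>
        rw [mul_smul_comm]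
        exact Submodule.smul_mem _ _ hx
end

section
/- Let n ≥ 1, let W be a finite set of nonzero vectors in ℕⁿ, and let u : W → ℤ. For each m ≥ 1 define A_m = { α ∈ ℕⁿ : ⟨α, w⟩ ≥ −m·u_w for all w ∈ W }, and let I_m be the ideal of ℂ[x₁, …, xₙ] spanned over ℂ by the monomials x^α with α ∈ A_m. Then there exists a positive integer s such that (I_s)^k = I_{sk} for every k ≥ 1. -/
theorem aux_extract {X : Type*} [AddCommMonoid X] (P : AddSubmonoid X) (hP : P.FG)
    (deg : X →+ ℕ) : ∃ s : ℕ, 0 < s ∧ ∀ x ∈ P, 2 * s ≤ deg x →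
      ∃ y ∈ P, ∃ z ∈ P, x = y + z ∧ deg y = s := by
  classical
  obtain ⟨S, hS⟩ := hP
  have hSP : ∀ g ∈ S, g ∈ P := fun g hg => hS ▸ AddSubmonoid.subset_closure hg
  set d : ℕ := ∏ g ∈ S, (if deg g = 0 then 1 else deg g) with hd
  have hdpos : 0 < d := by
    apply Finset.prod_pos
    intro g _
    split_ifs <;> omega
  have hdvd : ∀ g ∈ S, deg g ≠ 0 → deg g ∣ d := by
    intro g hg h0
    have := Finset.dvd_prod_of_mem (fun g => if deg g = 0 then 1 else deg g) hg
    simpa [h0] using this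
  set B : ℕ := (S.card + 1) * d with hB
  have hBpos : 0 < B := by positivity
  have step : ∀ x ∈ P, B ≤ deg x → ∃ y ∈ P, ∃ z ∈ P, x = y + z ∧ deg y = d := by
    intro x hx hdx
    rw [← hS, AddSubmonoid.mem_closure_finset'] at hx
    obtain ⟨c, rfl⟩ := hx
    have : ∃ g : S, d ≤ c g * deg g := by
      by_contra! hcon
      rw [map_sum] at hdx
      have h1 : ∑ g : S, deg (c g • (g : X)) ≤ ∑ g : S, d := by
        apply Finset.sum_le_sum
        intro g _
        simpa using (hcon g).le
      simp at h1
      simp at hdx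
      nlinarith
    obtain ⟨g, hg⟩ := this
    have h0 : deg g ≠ 0 := by
      intro h0
      rw [h0] at hg
      omega
    obtain ⟨e, he⟩ := hdvd g g.2 h0
    have hle : e ≤ c g := by
      rw [he, mul_comm] at hg
      exact Nat.le_of_mul_le_mul_right hg (Nat.pos_of_ne_zero h0)
    refine ⟨e • (g : X), P.nsmul_mem (hSP _ g.2) _,
      (c g - e) • (g : X) + ∑ i ∈ Finset.univ.erase g, c i • (i : X), ?_, ?_, ?_⟩
    · exact P.add_mem (P.nsmul_mem (hSP _ g.2) _)
        (P.sum_mem fun i _ => P.nsmul_mem (hSP _ i.2) _)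
    · rw [← add_assoc, ← add_nsmul, Nat.add_sub_cancel' hle]
      exact (Finset.add_sum_erase _ _ (Finset.mem_univ g)).symm
    · simp [he, mul_comm]
  have multi : ∀ N : ℕ, ∀ x ∈ P, B + N * d ≤ deg x →
      ∃ y ∈ P, ∃ z ∈ P, x = y + z ∧ deg y = N * d := by
    intro N
    induction N with
    | zero => intro x hx _; exact ⟨0, P.zero_mem, x, hx, by simp, by simp⟩
    | succ N ih =>
      intro x hx hdx
      obtain ⟨y, hy, z, hz, rfl, hyd⟩ := step x hx (by nlinarith)
      obtain ⟨y', hy', z', hz', rfl, hyd'⟩ := ih z hz (by rw [map_add] at hdx; nlinarith)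
      exact ⟨y + y', P.add_mem hy hy', z', hz', by rw [add_assoc], by
        rw [map_add, hyd, hyd']; ring⟩
  exact ⟨B, hBpos, fun x hx h => multi (S.card + 1) x hx (by omega)⟩

/-- The monoid of `(α, m, t)` with `⟨α,w⟩ + m u_w = t_w`. -/
def auxP (n : ℕ) (W : Finset (Fin n → ℕ)) (u : (Fin n → ℕ) → ℤ) :
    AddSubmonoid ((Fin n → ℕ) × ℕ × (W → ℕ)) where
  carrier := {x | ∀ w : W, (∑ i, (x.1 i : ℤ) * (w.1 i : ℤ)) + (x.2.1 : ℤ) * u w = (x.2.2 w : ℤ)}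
  zero_mem' := by simp
  add_mem' := by
    intro a b ha hb w
    have h1 := ha w
    have h2 := hb w
    simp only [Prod.fst_add, Prod.snd_add, Pi.add_apply, Nat.cast_add, add_mul,
      Finset.sum_add_distrib]
    linarith

theorem auxP_fg (n : ℕ) (W : Finset (Fin n → ℕ)) (u : (Fin n → ℕ) → ℤ) : (auxP n W u).FG := by
  apply AddSubmonoid.fg_of_subtractive
  intro x hx y hxy w
  have h1 := hx w
  have h2 := hxy w
  simp only [Prod.fst_add, Prod.snd_add, Pi.add_apply, Nat.cast_add, add_mul,
      Finset.sum_add_distrib] at h2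
  linarith

theorem aux_split (n : ℕ) (W : Finset (Fin n → ℕ)) (u : (Fin n → ℕ) → ℤ) :
    ∃ s : ℕ, 0 < s ∧ ∀ k : ℕ, 1 ≤ k → ∀ α : Fin n →₀ ℕ,
      (∀ w ∈ W, -(((s * (k + 1) : ℕ) : ℤ) * u w) ≤ ∑ i, (α i : ℤ) * (w i : ℤ)) →
      ∃ β γ : Fin n →₀ ℕ, α = β + γ ∧
        (∀ w ∈ W, -(((s * k : ℕ) : ℤ) * u w) ≤ ∑ i, (β i : ℤ) * (w i : ℤ)) ∧
        (∀ w ∈ W, -((s : ℤ) * u w) ≤ ∑ i, (γ i : ℤ) * (w i : ℤ)) := by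
  obtain ⟨s, hs, H⟩ := aux_extract (auxP n W u) (auxP_fg n W u)
    ((AddMonoidHom.fst ℕ (W → ℕ)).comp (AddMonoidHom.snd (Fin n → ℕ) (ℕ × (W → ℕ))))
  refine ⟨s, hs, fun k hk α hα => ?_⟩
  obtain ⟨y, hy, z, hz, hx, hd⟩ := H (⇑α, s * (k + 1), fun w =>
    ((∑ i, (α i : ℤ) * (w.1 i : ℤ)) + ((s * (k + 1) : ℕ) : ℤ) * u w).toNat) (by
      intro w
      have := hα w w.2
      exact (Int.toNat_of_nonneg (by linarith)).symm) (by
      simp only [AddMonoidHom.coe_comp, AddMonoidHom.coe_fst, AddMonoidHom.coe_snd,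
        Function.comp_apply]
      nlinarith)
  simp only [AddMonoidHom.coe_comp, AddMonoidHom.coe_fst, AddMonoidHom.coe_snd,
        Function.comp_apply] at hd
  have hz1 : z.2.1 = s * k := by
    have := congrArg (fun x => x.2.1) hx
    simp only [Prod.snd_add, Prod.fst_add, hd] at this
    nlinarith
  refine ⟨Finsupp.equivFunOnFinite.symm z.1, Finsupp.equivFunOnFinite.symm y.1, ?_, ?_, ?_⟩
  · ext i
    have := congrFun (congrArg (fun x => x.1) hx) i
    simp only [Prod.fst_add, Pi.add_apply] at this
    simp [this, add_comm]
  · intro w hw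
    have := hz ⟨w, hw⟩
    rw [hz1] at this
    simp only [Finsupp.equivFunOnFinite_symm_apply_apply]
    have h0 : (0 : ℤ) ≤ (z.2.2 ⟨w, hw⟩ : ℤ) := by positivity
    linarith
  · intro w hw
    have := hy ⟨w, hw⟩
    rw [hd] at this
    simp only [Finsupp.equivFunOnFinite_symm_apply_apply]
    have h0 : (0 : ℤ) ≤ (y.2.2 ⟨w, hw⟩ : ℤ) := by positivity
    linarith

open MvPolynomial in
/-- Stabilization: with `I_m` the ideal spanned by the monomials `x^α`,
`⟨α,w⟩ ≥ -m·u_w` for all `w ∈ W`, there is a positive integer `s` with `(I_s)^k = I_{sk}`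
for all `k ≥ 1`. -/
theorem exists_stable_multiple_pow_ideal
    (n : ℕ) (hn : 1 ≤ n) (W : Finset (Fin n → ℕ)) (hW : ∀ w ∈ W, w ≠ 0)
    (u : (Fin n → ℕ) → ℤ)
    (I : ℕ → Ideal (MvPolynomial (Fin n) ℂ))
    (hI : ∀ m : ℕ, I m = Ideal.span {p : MvPolynomial (Fin n) ℂ |
      ∃ α : Fin n →₀ ℕ,
        (∀ w ∈ W, -((m : ℤ) * u w) ≤ ∑ i, (α i : ℤ) * (w i : ℤ)) ∧
        p = monomial α 1}) :
    ∃ s : ℕ, 0 < s ∧ ∀ k : ℕ, 1 ≤ k → (I s) ^ k = I (s * k) := by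
  obtain ⟨s, hs, H⟩ := aux_split n W u
  refine ⟨s, hs, fun k hk => ?_⟩
  induction k, hk using Nat.le_induction with
  | base => simp
  | succ k hk ih =>
    rw [pow_succ, ih]
    apply le_antisymm
    · rw [hI (s * k), hI s, hI (s * (k + 1)), Ideal.span_mul_span', Ideal.span_le]
      rintro _ ⟨_, ⟨β, hβ, rfl⟩, _, ⟨γ, hγ, rfl⟩, rfl⟩
      refine Ideal.subset_span ⟨β + γ, ?_, by simp [monomial_mul]⟩
      intro w hw
      have h1 := hβ w hw
      have h2 := hγ w hw
      simp only [Finsupp.add_apply, Nat.cast_add, add_mul, Finset.sum_add_distrib]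
      push_cast at h1 ⊢
      linarith
    · rw [hI (s * (k + 1)), Ideal.span_le]
      rintro _ ⟨α, hα, rfl⟩
      obtain ⟨β, γ, rfl, hβ, hγ⟩ := H k hk α hα
      have : (monomial (β + γ) 1 : MvPolynomial (Fin n) ℂ) = monomial β 1 * monomial γ 1 := by
        simp [monomial_mul]
      rw [SetLike.mem_coe, this]
      refine Ideal.mul_mem_mul ?_ ?_
      · rw [hI]; exact Ideal.subset_span ⟨β, hβ, rfl⟩
      · rw [hI]; exact Ideal.subset_span ⟨γ, hγ, rfl⟩
end
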